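/- arXiv:1306.6810 — 2 statements merged into one kernel-verified Lean document; each statement's English description precedes it below -/
import Mathlib

section
/- Let n ≥ 2 and let g, ḡ be pseudo-Riemannian metrics of class C^1 on an open set U ⊆ ℝ^n, let ψ = (ψ_i) be continuous functions on U, and set Ψ = (1/(2(n+1))) ln|det(ḡ_{ij})/det(g_{ij})|, a^{ij} = e^{2Ψ} ḡ^{ij} and λ^i = −ψ_α a^{αi}. Then g and ḡ are geodesically related via ψ (i.e., Γ̄^h_{ij} = Γ^h_{ij} + ψ_i δ^h_j + ψ_j δ^h_i on U) if and only if the functions a^{ij} are differentiable on U and satisfy the Sinyukov-type system ∂_k a^{ij} + Γ^i_{kα} a^{αj} + Γ^j_{kα} a^{iα} = λ^i δ^j_k + λ^j δ^i_k on U for all indices i, j, k. -/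
noncomputable section
open scoped BigOperators

/-- Partial derivative `∂_i f` of `f : ℝⁿ → ℝ` in the `i`-th coordinate direction. -/
def pd {n : ℕ} (i : Fin n) (f : (Fin n → ℝ) → ℝ) (x : Fin n → ℝ) : ℝ :=
  fderiv ℝ f x (Pi.single i 1)

/-- The matrix `(g_{ij}(x))` of a two-index family of functions at a point `x`. -/
def matAt {n : ℕ} (g : Fin n → Fin n → (Fin n → ℝ) → ℝ) (x : Fin n → ℝ) :
    Matrix (Fin n) (Fin n) ℝ := Matrix.of fun i j => g i j x

/-- The components `g^{ij}(x)` of the pointwise inverse matrix. -/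
def ginv {n : ℕ} (g : Fin n → Fin n → (Fin n → ℝ) → ℝ) (i j : Fin n) (x : Fin n → ℝ) : ℝ :=
  (matAt g x)⁻¹ i j

/-- `g` is a pseudo-Riemannian metric of class `C^r` on `U`: the components are
symmetric, of class `C^r`, and the matrix `(g_{ij}(x))` is invertible for every `x ∈ U`. -/
structure IsMetric {n : ℕ} (r : WithTop ℕ∞) (g : Fin n → Fin n → (Fin n → ℝ) → ℝ)
    (U : Set (Fin n → ℝ)) : Prop where
  symm : ∀ i j, ∀ x ∈ U, g i j x = g j i x
  contDiff : ∀ i j, ContDiffOn ℝ r (g i j) U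
  inv : ∀ x ∈ U, IsUnit (matAt g x).det

/-- Christoffel symbols `Γ^h_{ij} = (1/2) g^{hk}(∂_i g_{jk} + ∂_j g_{ik} − ∂_k g_{ij})`. -/
def Christoffel {n : ℕ} (g : Fin n → Fin n → (Fin n → ℝ) → ℝ) (h i j : Fin n)
    (x : Fin n → ℝ) : ℝ :=
  (1/2) * ∑ k, ginv g h k x * (pd i (g j k) x + pd j (g i k) x - pd k (g i j) x)

/-- `g` and `gbar` are geodesically related via the 1-form `ψ`:
`Γ̄^h_{ij} = Γ^h_{ij} + ψ_i δ^h_j + ψ_j δ^h_i` on `U`. -/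
def GeodesicallyRelated {n : ℕ} (g gbar : Fin n → Fin n → (Fin n → ℝ) → ℝ)
    (ψ : Fin n → (Fin n → ℝ) → ℝ) (U : Set (Fin n → ℝ)) : Prop :=
  ∀ h i j, ∀ x ∈ U, Christoffel gbar h i j x =
    Christoffel g h i j x + ψ i x * (if h = j then (1:ℝ) else 0)
      + ψ j x * (if h = i then (1:ℝ) else 0)

/-- The function `Ψ = (1/(2(n+1))) ln|det ḡ / det g|`. -/
def PsiFun {n : ℕ} (g gbar : Fin n → Fin n → (Fin n → ℝ) → ℝ) (x : Fin n → ℝ) : ℝ :=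
  (1 / (2 * ((n : ℝ) + 1))) * Real.log |(matAt gbar x).det / (matAt g x).det|

/-- The Sinyukov tensor `a^{ij} = e^{2Ψ} ḡ^{ij}`. -/
def sinA {n : ℕ} (g gbar : Fin n → Fin n → (Fin n → ℝ) → ℝ) (i j : Fin n)
    (x : Fin n → ℝ) : ℝ :=
  Real.exp (2 * PsiFun g gbar x) * ginv gbar i j x

/-- The Sinyukov vector `λ^i = −ψ_α a^{αi}`. -/
def sinLam {n : ℕ} (g gbar : Fin n → Fin n → (Fin n → ℝ) → ℝ)
    (ψ : Fin n → (Fin n → ℝ) → ℝ) (i : Fin n) (x : Fin n → ℝ) : ℝ :=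
  - ∑ a, ψ a x * sinA g gbar a i x

open scoped Matrix

/-- The matrix `(Γ^i_{kj}(x))_{i,j}` of the Levi-Civita connection in the direction `∂_k`. -/
def connMat {n : ℕ} (g : Fin n → Fin n → (Fin n → ℝ) → ℝ) (k : Fin n) (x : Fin n → ℝ) :
    Matrix (Fin n) (Fin n) ℝ := Matrix.of fun i j => Christoffel g i k j x

/-- The entrywise partial derivative `∂_k` of the matrix `(g_{ij})` at `x`. -/
def pdMat {n : ℕ} (k : Fin n) (g : Fin n → Fin n → (Fin n → ℝ) → ℝ) (x : Fin n → ℝ) :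
    Matrix (Fin n) (Fin n) ℝ := Matrix.of fun i j => pd k (g i j) x

section Calculus

variable {n : ℕ} {g : Fin n → Fin n → (Fin n → ℝ) → ℝ} {x : Fin n → ℝ}

theorem hasFDerivAt_det_matAt (hd : ∀ i j, DifferentiableAt ℝ (g i j) x) :
    ∃ L : (Fin n → ℝ) →L[ℝ] ℝ, HasFDerivAt (fun y => (matAt g y).det) L x ∧
      ∀ k, L (Pi.single k 1) = ((matAt g x).adjugate * pdMat k g x).trace := by
  let F : ContinuousMultilinearMap ℝ (fun _ : Fin n => Fin n → ℝ) ℝ :=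
    { toMultilinearMap := (Matrix.detRowAlternating (R := ℝ) (n := Fin n)).toMultilinearMap
      cont := by
        change Continuous fun M : Matrix (Fin n) (Fin n) ℝ => M.det
        exact Continuous.matrix_det continuous_id }
  have hrow : ∀ i, HasFDerivAt (fun y j => g i j y)
      (ContinuousLinearMap.pi fun j => fderiv ℝ (g i j) x) x :=
    fun i => hasFDerivAt_pi.2 fun j => (hd i j).hasFDerivAt
  refine ⟨_, HasFDerivAt.multilinear_comp (f := F) hrow, fun k => ?_⟩
  rw [_root_.sum_apply, Matrix.trace_mul_comm, Matrix.trace]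
  refine Finset.sum_congr rfl fun i _ => ?_
  change ((matAt g x).updateRow i (pdMat k g x i)).det = _
  rw [← Matrix.cramer_transpose_apply, Matrix.cramer_eq_adjugate_mulVec, Matrix.diag_apply,
    Matrix.mul_apply, ← Matrix.adjugate_transpose, Matrix.mulVec, dotProduct]
  exact Finset.sum_congr rfl fun j _ => mul_comm _ _

theorem differentiableAt_det_matAt (hd : ∀ i j, DifferentiableAt ℝ (g i j) x) :
    DifferentiableAt ℝ (fun y => (matAt g y).det) x :=
  let ⟨_, hL, _⟩ := hasFDerivAt_det_matAt hd
  hL.differentiableAt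

theorem pd_det_matAt (hd : ∀ i j, DifferentiableAt ℝ (g i j) x) (k : Fin n) :
    pd k (fun y => (matAt g y).det) x = ((matAt g x).adjugate * pdMat k g x).trace := by
  obtain ⟨L, hL, h⟩ := hasFDerivAt_det_matAt hd
  rw [pd, hL.fderiv, h]

/-- Jacobi's formula. -/
theorem pd_log_det_matAt (hd : ∀ i j, DifferentiableAt ℝ (g i j) x)
    (hx : IsUnit (matAt g x).det) (k : Fin n) :
    pd k (fun y => Real.log (matAt g y).det) x = ((matAt g x)⁻¹ * pdMat k g x).trace := by
  rw [pd, fderiv.log (differentiableAt_det_matAt hd) hx.ne_zero, Matrix.inv_def,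
    Matrix.smul_mul, Matrix.trace_smul, ← pd_det_matAt hd k, Ring.inverse_eq_inv']
  rfl

theorem differentiableAt_ginv (hd : ∀ i j, DifferentiableAt ℝ (g i j) x)
    (hx : IsUnit (matAt g x).det) (i j : Fin n) : DifferentiableAt ℝ (ginv g i j) x := by
  have h : ginv g i j = fun y => ((matAt g y).det)⁻¹ *
      (matAt (fun a b y => if a = j then (Pi.single i 1 : Fin n → ℝ) b else g a b y) y).det := by
    funext y
    rw [ginv, Matrix.inv_def, Ring.inverse_eq_inv', Matrix.smul_apply, Matrix.adjugate_apply,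
      smul_eq_mul]
    congr 2
    ext a b
    by_cases hab : a = j <;> simp [matAt, Matrix.updateRow_apply, hab]
  rw [h]
  refine ((differentiableAt_det_matAt hd).inv hx.ne_zero).mul
    (differentiableAt_det_matAt fun a b => ?_)
  by_cases hab : a = j <;> simp [hab, hd]

theorem pdMat_ginv (hd : ∀ i j, DifferentiableAt ℝ (g i j) x)
    (hx : ∀ᶠ y in nhds x, IsUnit (matAt g y).det) (k : Fin n) :
    pdMat k (ginv g) x = -((matAt g x)⁻¹ * pdMat k g x * (matAt g x)⁻¹) := by
  have hx₀ := hx.self_of_nhds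
  have key : pdMat k g x * (matAt g x)⁻¹ + matAt g x * pdMat k (ginv g) x = 0 := by
    ext i j
    have hconst : (fun y => ∑ a, g i a y * ginv g a j y) =ᶠ[nhds x]
        fun _ => (1 : Matrix (Fin n) (Fin n) ℝ) i j := by
      filter_upwards [hx] with y hy
      rw [← Matrix.mul_nonsing_inv _ hy, Matrix.mul_apply]
      rfl
    have hsum : HasFDerivAt (fun y => ∑ a, g i a y * ginv g a j y)
        (∑ a, (g i a x • fderiv ℝ (ginv g a j) x + ginv g a j x • fderiv ℝ (g i a) x)) x :=
      HasFDerivAt.fun_sum fun a _ =>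
        (hd i a).hasFDerivAt.mul (differentiableAt_ginv hd hx₀ a j).hasFDerivAt
    have h0 := (hsum.congr_of_eventuallyEq hconst.symm).unique (hasFDerivAt_const _ _)
    have h1 := DFunLike.congr_fun h0 (Pi.single k 1)
    simp only [_root_.sum_apply, _root_.add_apply,
      _root_.smul_apply, smul_eq_mul, _root_.zero_apply,
      Finset.sum_add_distrib] at h1
    rw [Matrix.add_apply, Matrix.mul_apply, Matrix.mul_apply, Matrix.zero_apply, ← h1, add_comm]
    congr 1
    exact Finset.sum_congr rfl fun a _ => mul_comm _ _
  have h2 := congrArg ((matAt g x)⁻¹ * ·) key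
  simp only [Matrix.mul_add, Matrix.mul_zero, ← Matrix.mul_assoc,
    Matrix.nonsing_inv_mul _ hx₀, Matrix.one_mul] at h2
  exact eq_neg_of_add_eq_zero_right h2

end Calculus

namespace IsMetric

variable {n : ℕ} {g : Fin n → Fin n → (Fin n → ℝ) → ℝ} {U : Set (Fin n → ℝ)} {x : Fin n → ℝ}

theorem differentiableAt (hg : IsMetric 1 g U) (hU : IsOpen U) (hx : x ∈ U) (i j : Fin n) :
    DifferentiableAt ℝ (g i j) x :=
  ((hg.contDiff i j).differentiableOn one_ne_zero).differentiableAt (hU.mem_nhds hx)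

theorem pd_symm (hg : IsMetric 1 g U) (hU : IsOpen U) (hx : x ∈ U) (k i j : Fin n) :
    pd k (g i j) x = pd k (g j i) x := by
  have h : g i j =ᶠ[nhds x] g j i := by
    filter_upwards [hU.mem_nhds hx] with y hy using hg.symm i j y hy
  rw [pd, pd, h.fderiv_eq]

theorem christoffel_symm (hg : IsMetric 1 g U) (hU : IsOpen U) (hx : x ∈ U) (h i j : Fin n) :
    Christoffel g h i j x = Christoffel g h j i x := by
  unfold Christoffel
  refine congrArg _ (Finset.sum_congr rfl fun k _ => ?_)
  rw [hg.pd_symm hU hx k i j]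
  ring

theorem transpose_matAt (hg : IsMetric 1 g U) (hx : x ∈ U) : (matAt g x)ᵀ = matAt g x :=
  Matrix.ext fun i j => hg.symm j i x hx

theorem transpose_inv_matAt (hg : IsMetric 1 g U) (hx : x ∈ U) :
    ((matAt g x)⁻¹)ᵀ = (matAt g x)⁻¹ := by
  rw [Matrix.transpose_nonsing_inv, hg.transpose_matAt hx]

theorem matAt_mul_connMat_apply (hg : IsMetric 1 g U) (hx : x ∈ U) (k i j : Fin n) :
    (matAt g x * connMat g k x) i j =
      (1 / 2) * (pd k (g j i) x + pd j (g k i) x - pd i (g k j) x) := by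
  have h : connMat g k x = (matAt g x)⁻¹ * Matrix.of fun i j =>
      (1 / 2) * (pd k (g j i) x + pd j (g k i) x - pd i (g k j) x) := by
    ext a b
    rw [Matrix.mul_apply, connMat, Matrix.of_apply, Christoffel, Finset.mul_sum]
    refine Finset.sum_congr rfl fun c _ => ?_
    rw [Matrix.of_apply, ginv]
    ring
  rw [h, Matrix.mul_nonsing_inv_cancel_left _ _ (hg.inv x hx), Matrix.of_apply]

/-- Metric compatibility of the Levi-Civita connection. -/
theorem pdMat_eq (hg : IsMetric 1 g U) (hU : IsOpen U) (hx : x ∈ U) (k : Fin n) :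
    pdMat k g x = (connMat g k x)ᵀ * matAt g x + matAt g x * connMat g k x := by
  have h : (connMat g k x)ᵀ * matAt g x = (matAt g x * connMat g k x)ᵀ := by
    rw [Matrix.transpose_mul, hg.transpose_matAt hx]
  ext i j
  rw [h, Matrix.add_apply, Matrix.transpose_apply, hg.matAt_mul_connMat_apply hx,
    hg.matAt_mul_connMat_apply hx, hg.pd_symm hU hx k j i, pdMat, Matrix.of_apply]
  ring

theorem pdMat_ginv_eq (hg : IsMetric 1 g U) (hU : IsOpen U) (hx : x ∈ U) (k : Fin n) :
    pdMat k (ginv g) x =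
      -(connMat g k x * (matAt g x)⁻¹) - (matAt g x)⁻¹ * (connMat g k x)ᵀ := by
  have hev : ∀ᶠ y in nhds x, IsUnit (matAt g y).det := by
    filter_upwards [hU.mem_nhds hx] with y hy using hg.inv y hy
  rw [pdMat_ginv (hg.differentiableAt hU hx) hev, hg.pdMat_eq hU hx, Matrix.mul_add,
    Matrix.add_mul, Matrix.nonsing_inv_mul_cancel_left _ _ (hg.inv x hx), ← Matrix.mul_assoc,
    Matrix.mul_nonsing_inv_cancel_right _ _ (hg.inv x hx)]
  abel

/-- The contracted Christoffel symbols are `∂_k ln √|det g|`. -/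
theorem pd_log_det (hg : IsMetric 1 g U) (hU : IsOpen U) (hx : x ∈ U) (k : Fin n) :
    pd k (fun y => Real.log (matAt g y).det) x = 2 * (connMat g k x).trace := by
  rw [pd_log_det_matAt (hg.differentiableAt hU hx) (hg.inv x hx), hg.pdMat_eq hU hx,
    Matrix.mul_add, Matrix.trace_add, Matrix.nonsing_inv_mul_cancel_left _ _ (hg.inv x hx),
    Matrix.trace_mul_comm, Matrix.mul_nonsing_inv_cancel_right _ _ (hg.inv x hx),
    Matrix.trace_transpose]
  ring

theorem differentiableAt_log_det (hg : IsMetric 1 g U) (hU : IsOpen U) (hx : x ∈ U) :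
    DifferentiableAt ℝ (fun y => Real.log (matAt g y).det) x :=
  (differentiableAt_det_matAt (hg.differentiableAt hU hx)).log (hg.inv x hx).ne_zero

end IsMetric

section Sinyukov

variable {n : ℕ} {g gbar : Fin n → Fin n → (Fin n → ℝ) → ℝ} {U : Set (Fin n → ℝ)}
  {x : Fin n → ℝ}

theorem psiFun_eventuallyEq (hU : IsOpen U) (hg : IsMetric 1 g U) (hgbar : IsMetric 1 gbar U)
    (hx : x ∈ U) : PsiFun g gbar =ᶠ[nhds x] fun y => (1 / (2 * ((n : ℝ) + 1))) *
      (Real.log (matAt gbar y).det - Real.log (matAt g y).det) := by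
  filter_upwards [hU.mem_nhds hx] with y hy
  rw [PsiFun, Real.log_abs, Real.log_div (hgbar.inv y hy).ne_zero (hg.inv y hy).ne_zero]

theorem differentiableAt_psiFun (hU : IsOpen U) (hg : IsMetric 1 g U)
    (hgbar : IsMetric 1 gbar U) (hx : x ∈ U) : DifferentiableAt ℝ (PsiFun g gbar) x :=
  (((hgbar.differentiableAt_log_det hU hx).sub
    (hg.differentiableAt_log_det hU hx)).const_mul _).congr_of_eventuallyEq
    (psiFun_eventuallyEq hU hg hgbar hx)

theorem pd_psiFun (hU : IsOpen U) (hg : IsMetric 1 g U) (hgbar : IsMetric 1 gbar U)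
    (hx : x ∈ U) (k : Fin n) :
    ((n : ℝ) + 1) * pd k (PsiFun g gbar) x =
      (connMat gbar k x - connMat g k x).trace := by
  have hb := hgbar.differentiableAt_log_det hU hx
  have ha := hg.differentiableAt_log_det hU hx
  have hn : (n : ℝ) + 1 ≠ 0 := by positivity
  have h : pd k (PsiFun g gbar) x = (1 / (2 * ((n : ℝ) + 1))) *
      (pd k (fun y => Real.log (matAt gbar y).det) x
        - pd k (fun y => Real.log (matAt g y).det) x) := by
    rw [pd, (psiFun_eventuallyEq hU hg hgbar hx).fderiv_eq, fderiv_const_mul (hb.fun_sub ha),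
      fderiv_fun_sub hb ha]
    rfl
  rw [h, hgbar.pd_log_det hU hx, hg.pd_log_det hU hx, Matrix.trace_sub]
  field_simp

theorem differentiableAt_sinA (hU : IsOpen U) (hg : IsMetric 1 g U)
    (hgbar : IsMetric 1 gbar U) (hx : x ∈ U) (i j : Fin n) :
    DifferentiableAt ℝ (sinA g gbar i j) x :=
  ((differentiableAt_psiFun hU hg hgbar hx).const_mul 2).exp.mul
    (differentiableAt_ginv (hgbar.differentiableAt hU hx) (hgbar.inv x hx) i j)

theorem matAt_sinA (g gbar : Fin n → Fin n → (Fin n → ℝ) → ℝ) (x : Fin n → ℝ) :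
    matAt (sinA g gbar) x = Real.exp (2 * PsiFun g gbar x) • (matAt gbar x)⁻¹ :=
  rfl

theorem pdMat_sinA (hU : IsOpen U) (hg : IsMetric 1 g U) (hgbar : IsMetric 1 gbar U)
    (hx : x ∈ U) (k : Fin n) :
    pdMat k (sinA g gbar) x = (2 * pd k (PsiFun g gbar) x) • matAt (sinA g gbar) x
      - connMat gbar k x * matAt (sinA g gbar) x
      - matAt (sinA g gbar) x * (connMat gbar k x)ᵀ := by
  have hΨ := differentiableAt_psiFun hU hg hgbar hx
  have h : pdMat k (sinA g gbar) x = (2 * pd k (PsiFun g gbar) x) • matAt (sinA g gbar) x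
      + Real.exp (2 * PsiFun g gbar x) • pdMat k (ginv gbar) x := by
    ext i j
    have hd := ((hΨ.hasFDerivAt.const_mul 2).exp.mul
      (differentiableAt_ginv (hgbar.differentiableAt hU hx) (hgbar.inv x hx) i j).hasFDerivAt)
    have hpd : pd k (sinA g gbar i j) x = _ := DFunLike.congr_fun hd.fderiv (Pi.single k 1)
    simp only [pdMat, matAt, sinA, Matrix.add_apply, Matrix.smul_apply, Matrix.of_apply,
      smul_eq_mul]
    refine hpd.trans ?_
    simp only [pd, _root_.add_apply, _root_.smul_apply, smul_eq_mul]
    ring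
  rw [h, hgbar.pdMat_ginv_eq hU hx, matAt_sinA]
  simp only [Matrix.mul_smul, Matrix.smul_mul, smul_sub, smul_neg]
  abel

/-- In terms of the difference tensor of the two connections, the Sinyukov system at a point is
algebraic. -/
theorem covariantDeriv_sinA (hU : IsOpen U) (hg : IsMetric 1 g U) (hgbar : IsMetric 1 gbar U)
    (hx : x ∈ U) (i j k : Fin n) :
    pd k (sinA g gbar i j) x + (∑ a, Christoffel g i k a x * sinA g gbar a j x)
        + (∑ a, Christoffel g j k a x * sinA g gbar i a x)
      = 2 * pd k (PsiFun g gbar) x * sinA g gbar i j x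
        - (∑ a, (Christoffel gbar i k a x - Christoffel g i k a x) * sinA g gbar a j x)
        - ∑ a, (Christoffel gbar j k a x - Christoffel g j k a x) * sinA g gbar i a x := by
  have h := congrFun (congrFun (pdMat_sinA hU hg hgbar hx k) i) j
  simp only [Matrix.sub_apply, Matrix.smul_apply, Matrix.mul_apply, pdMat, matAt, connMat,
    Matrix.of_apply, Matrix.transpose_apply, smul_eq_mul] at h
  simp only [sub_mul, Finset.sum_sub_distrib, h, mul_comm (sinA g gbar i _ x)]
  ring

theorem sinA_symm (hgbar : IsMetric 1 gbar U) (hx : x ∈ U) (i j : Fin n) :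
    sinA g gbar i j x = sinA g gbar j i x :=
  congrArg (Real.exp (2 * PsiFun g gbar x) * ·)
    (congrFun (congrFun (hgbar.transpose_inv_matAt hx) j) i)

theorem isUnit_det_matAt_sinA (hgbar : IsMetric 1 gbar U) (hx : x ∈ U) :
    IsUnit (matAt (sinA g gbar) x).det := by
  rw [matAt_sinA, Matrix.det_smul, isUnit_iff_ne_zero]
  exact mul_ne_zero (pow_ne_zero _ (Real.exp_ne_zero _))
    (Matrix.isUnit_nonsing_inv_det _ (hgbar.inv x hx)).ne_zero

end Sinyukov

/-- A tensor `S^i_{kj}`, symmetric in its lower indices, whose contractions with an invertible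
symmetric `a` satisfy `S^i_{kα} a^{αj} + S^j_{kα} a^{αi} = 2 φ_k a^{ij}`, where
`(n + 1) φ_k = S^α_{kα}`, vanishes. -/
theorem eq_zero_of_mul_add_mul_transpose {n : ℕ} {A : Matrix (Fin n) (Fin n) ℝ}
    (hA : IsUnit A.det) (hAT : Aᵀ = A) {S : Fin n → Matrix (Fin n) (Fin n) ℝ}
    (hS : ∀ i j k, S k i j = S j i k) {φ : Fin n → ℝ}
    (htr : ∀ k, ((n : ℝ) + 1) * φ k = (S k).trace)
    (h : ∀ k, S k * A + A * (S k)ᵀ = (2 * φ k) • A) (k : Fin n) : S k = 0 := by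
  have hφ : ∀ k, φ k = 0 := by
    intro k
    have h1 := congrArg (fun M => (A⁻¹ * M).trace) (h k)
    simp only [Matrix.mul_add, Matrix.trace_add, Matrix.nonsing_inv_mul_cancel_left _ _ hA,
      Matrix.trace_transpose, Matrix.mul_smul, Matrix.trace_smul, Matrix.nonsing_inv_mul _ hA,
      Matrix.trace_one, Fintype.card_fin, smul_eq_mul] at h1
    rw [Matrix.trace_mul_comm, Matrix.mul_nonsing_inv_cancel_right _ _ hA] at h1
    linarith [htr k]
  have hskew : ∀ k, (A⁻¹ * S k)ᵀ = -(A⁻¹ * S k) := by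
    intro k
    have h1 := congrArg (fun M => A⁻¹ * M * A⁻¹) (h k)
    simp only [hφ, mul_zero, zero_smul, Matrix.mul_add, Matrix.add_mul,
      Matrix.zero_mul, Matrix.nonsing_inv_mul_cancel_left _ _ hA] at h1
    rw [← Matrix.mul_assoc, Matrix.mul_nonsing_inv_cancel_right _ _ hA] at h1
    rw [Matrix.transpose_mul, Matrix.transpose_nonsing_inv, hAT]
    exact eq_neg_of_add_eq_zero_right h1
  have hsk : ∀ k i j, (A⁻¹ * S k) j i = -(A⁻¹ * S k) i j := fun k i j =>
    congrFun (congrFun (hskew k) i) j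
  have hsy : ∀ k i j, (A⁻¹ * S k) i j = (A⁻¹ * S j) i k := fun k i j => by
    simp only [Matrix.mul_apply, hS _ j k]
  have hzero : A⁻¹ * S k = 0 := by
    ext i j
    rw [Matrix.zero_apply]
    linarith [hsk k i j, hsy k i j, hsk j i k, hsy j k i, hsk i j k, hsy i j k]
  rw [← Matrix.mul_nonsing_inv_cancel_left A (S k) hA, hzero, Matrix.mul_zero]

/-- The Levi-Civita equations are equivalent to the Sinyukov-type system
`∇_k a^{ij} = λ^i δ^j_k + λ^j δ^i_k` for `a^{ij} = e^{2Ψ} ḡ^{ij}`, `λ^i = −ψ_α a^{αi}`. -/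
theorem levi_civita_iff_sinyukov
    {n : ℕ} (hn : 2 ≤ n) (U : Set (Fin n → ℝ)) (hU : IsOpen U)
    (g gbar : Fin n → Fin n → (Fin n → ℝ) → ℝ)
    (hg : IsMetric 1 g U) (hgbar : IsMetric 1 gbar U)
    (ψ : Fin n → (Fin n → ℝ) → ℝ) (hψ : ∀ i, ContinuousOn (ψ i) U) :
    GeodesicallyRelated g gbar ψ U ↔
      ((∀ i j, ∀ x ∈ U, DifferentiableAt ℝ (sinA g gbar i j) x) ∧
        ∀ i j k, ∀ x ∈ U,
          pd k (sinA g gbar i j) x + (∑ a, Christoffel g i k a x * sinA g gbar a j x)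
              + (∑ a, Christoffel g j k a x * sinA g gbar i a x)
            = sinLam g gbar ψ i x * (if j = k then (1:ℝ) else 0)
              + sinLam g gbar ψ j x * (if i = k then (1:ℝ) else 0)) := by

  refine ⟨fun h => ⟨fun i j x hx => differentiableAt_sinA hU hg hgbar hx i j,
    fun i j k x hx => ?_⟩, fun ⟨_, h⟩ => ?_⟩
  · have hn' : (n : ℝ) + 1 ≠ 0 := by positivity
    have hT : ∀ h i j, Christoffel gbar h i j x - Christoffel g h i j x =
        ψ i x * (if h = j then (1:ℝ) else 0) + ψ j x * (if h = i then (1:ℝ) else 0) :=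
      fun a b c => by rw [h a b c x hx]; ring
    have hΨ : pd k (PsiFun g gbar) x = ψ k x := by
      apply mul_left_cancel₀ hn'
      rw [pd_psiFun hU hg hgbar hx k]
      simp only [Matrix.trace, Matrix.diag_apply, Matrix.sub_apply, connMat, Matrix.of_apply, hT]
      simp [Finset.sum_add_distrib]
      ring
    have hsym : ∑ a, (Christoffel gbar j k a x - Christoffel g j k a x) * sinA g gbar i a x =
        ∑ a, (Christoffel gbar j k a x - Christoffel g j k a x) * sinA g gbar a i x :=
      Finset.sum_congr rfl fun a _ => by rw [sinA_symm hgbar hx i a]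
    rw [covariantDeriv_sinA hU hg hgbar hx, hΨ, hsym]
    simp only [hT, sinLam, add_mul, Finset.sum_add_distrib, mul_assoc, ite_mul, zero_mul,
      mul_ite, mul_zero, mul_one, Finset.sum_ite_eq, Finset.mem_univ, if_true]
    rw [sinA_symm hgbar hx j i]
    split_ifs <;> ring_nf <;> simp
  · intro a b c x hx
    let S : Fin n → Matrix (Fin n) (Fin n) ℝ := fun k => Matrix.of fun i j =>
      Christoffel gbar i k j x - Christoffel g i k j x - ψ k x * (if i = j then (1:ℝ) else 0)
        - ψ j x * (if i = k then (1:ℝ) else 0)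
    have hS : S b = 0 := by
      refine eq_zero_of_mul_add_mul_transpose (isUnit_det_matAt_sinA (g := g) hgbar hx)
        (Matrix.ext fun i j => sinA_symm hgbar hx j i) (φ := fun k => pd k (PsiFun g gbar) x - ψ k x)
        (fun i j k => ?_) (fun k => ?_) (fun k => ?_) b
      · simp only [S, Matrix.of_apply]
        rw [hgbar.christoffel_symm hU hx i k j, hg.christoffel_symm hU hx i k j]
        ring
      · rw [mul_sub, pd_psiFun hU hg hgbar hx k]
        simp [Matrix.trace, S, connMat, Finset.sum_sub_distrib]
        ring
      · ext i j
        have hk := h i j k x hx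
        rw [covariantDeriv_sinA hU hg hgbar hx] at hk
        have hsym : ∑ a, ψ a x * sinA g gbar i a x = ∑ a, ψ a x * sinA g gbar a i x :=
          Finset.sum_congr rfl fun a _ => by rw [sinA_symm hgbar hx i a]
        have h1 : (S k * matAt (sinA g gbar) x) i j =
            (∑ a, (Christoffel gbar i k a x - Christoffel g i k a x) * sinA g gbar a j x)
              - ψ k x * sinA g gbar i j x
              + sinLam g gbar ψ j x * (if i = k then (1:ℝ) else 0) := by
          simp only [S, Matrix.mul_apply, matAt, Matrix.of_apply, sub_mul, Finset.sum_sub_distrib,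
            sinLam]
          split_ifs <;> simp <;> ring
        have h2 : (matAt (sinA g gbar) x * (S k)ᵀ) i j =
            (∑ a, (Christoffel gbar j k a x - Christoffel g j k a x) * sinA g gbar i a x)
              - ψ k x * sinA g gbar i j x
              + sinLam g gbar ψ i x * (if j = k then (1:ℝ) else 0) := by
          simp only [S, Matrix.mul_apply, matAt, Matrix.of_apply, Matrix.transpose_apply,
            mul_comm (sinA g gbar i _ x), sub_mul, Finset.sum_sub_distrib, sinLam, ← hsym]
          split_ifs <;> simp <;> ring
        rw [Matrix.add_apply, h1, h2, Matrix.smul_apply, smul_eq_mul, matAt, Matrix.of_apply]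
        linarith
    have h0 := congrFun (congrFun hS a) c
    simp only [S, Matrix.of_apply, Matrix.zero_apply] at h0
    linarith
end
end

section
/- Let n ≥ 2, let g be a pseudo-Riemannian metric of class C^1 on an open set U ⊆ ℝ^n, let a = (a^{ij}) be a symmetric family of differentiable functions on U and λ = (λ^i) continuous functions on U satisfying ∂_k a^{ij} + Γ^i_{kα} a^{αj} + Γ^j_{kα} a^{iα} = λ^i δ^j_k + λ^j δ^i_k on U for all i, j, k. Then the function a^{αβ} g_{αβ} (the trace of a with respect to g) is differentiable on U and λ^i = (1/2) g^{ik} ∂_k (a^{αβ} g_{αβ}) for each i; in particular λ is uniquely determined by a and g. -/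
noncomputable section
open scoped BigOperators

/-- Partial derivatives depend only on the germ of the function. -/
lemma pd_congr {n : ℕ} {U : Set (Fin n → ℝ)} (hU : IsOpen U) {f₁ f₂ : (Fin n → ℝ) → ℝ}
    (h : ∀ x ∈ U, f₁ x = f₂ x) {x : Fin n → ℝ} (hx : x ∈ U) (k : Fin n) :
    pd k f₁ x = pd k f₂ x := by
  have hev : f₁ =ᶠ[nhds x] f₂ := Filter.eventuallyEq_of_mem (hU.mem_nhds hx) h
  unfold pd
  rw [hev.fderiv_eq]

/-- Product rule for the contraction `a^{cd} g_{cd}`. -/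
lemma pd_sum_mul {n : ℕ} {a g : Fin n → Fin n → (Fin n → ℝ) → ℝ} {x : Fin n → ℝ}
    (ha : ∀ c d, DifferentiableAt ℝ (a c d) x) (hg : ∀ c d, DifferentiableAt ℝ (g c d) x)
    (k : Fin n) :
    pd k (fun y => ∑ c, ∑ d, a c d y * g c d y) x =
      ∑ c, ∑ d, (g c d x * pd k (a c d) x + a c d x * pd k (g c d) x) := by
  have h : HasFDerivAt (fun y => ∑ c, ∑ d, a c d y * g c d y)
      (∑ c, ∑ d, (a c d x • fderiv ℝ (g c d) x + g c d x • fderiv ℝ (a c d) x)) x :=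
    HasFDerivAt.fun_sum fun c _ => HasFDerivAt.fun_sum fun d _ =>
      (ha c d).hasFDerivAt.mul (hg c d).hasFDerivAt
  unfold pd
  rw [h.fderiv]
  simp [add_comm]

/-- Lowering the upper index of the Christoffel symbols. -/
lemma sum_mul_christoffel {n : ℕ} {g : Fin n → Fin n → (Fin n → ℝ) → ℝ} {x : Fin n → ℝ}
    (hinv : IsUnit (matAt g x).det) (j k c : Fin n) :
    ∑ i, g j i x * Christoffel g i k c x =
      (1/2) * (pd k (g c j) x + pd c (g k j) x - pd j (g k c) x) := by
  have h := congrFun (congrArg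
    (fun M => M.mulVec fun l => pd k (g c l) x + pd c (g k l) x - pd l (g k c) x)
    (Matrix.mul_nonsing_inv _ hinv)) j
  simp only [← Matrix.mulVec_mulVec, Matrix.one_mulVec] at h
  rw [← h]
  simp only [Matrix.mulVec, dotProduct, Christoffel, ginv, matAt, Matrix.of_apply,
    Finset.mul_sum]
  refine Finset.sum_congr rfl fun i _ => Finset.sum_congr rfl fun l _ => ?_
  ring

/-- The Levi-Civita connection is compatible with the metric. -/
lemma IsMetric.pd_eq_christoffel {n : ℕ} {U : Set (Fin n → ℝ)} (hU : IsOpen U)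
    {r : WithTop ℕ∞} {g : Fin n → Fin n → (Fin n → ℝ) → ℝ} (hg : IsMetric r g U)
    {x : Fin n → ℝ} (hx : x ∈ U) (k c d : Fin n) :
    pd k (g c d) x =
      (∑ i, g d i x * Christoffel g i k c x) + ∑ i, g c i x * Christoffel g i k d x := by
  rw [sum_mul_christoffel (hg.inv x hx), sum_mul_christoffel (hg.inv x hx),
    pd_congr hU (hg.symm d c) hx k]
  ring

/-- In the Sinyukov system `∇_k a^{ij} = λ^i δ^j_k + λ^j δ^i_k`, the vector `λ` is
determined by `a` and `g`: `λ^i = (1/2) g^{ik} ∂_k (a^{αβ} g_{αβ})`. -/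
theorem sinyukov_lambda_determined
    {n : ℕ} (hn : 2 ≤ n) (U : Set (Fin n → ℝ)) (hU : IsOpen U)
    (g : Fin n → Fin n → (Fin n → ℝ) → ℝ) (hg : IsMetric 1 g U)
    (a : Fin n → Fin n → (Fin n → ℝ) → ℝ)
    (hasymm : ∀ i j, ∀ x ∈ U, a i j x = a j i x)
    (hadiff : ∀ i j, ∀ x ∈ U, DifferentiableAt ℝ (a i j) x)
    (lam : Fin n → (Fin n → ℝ) → ℝ) (hlam : ∀ i, ContinuousOn (lam i) U)
    (hsin : ∀ i j k, ∀ x ∈ U,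
      pd k (a i j) x + (∑ c, Christoffel g i k c x * a c j x)
          + (∑ c, Christoffel g j k c x * a i c x)
        = lam i x * (if j = k then (1:ℝ) else 0) + lam j x * (if i = k then (1:ℝ) else 0)) :
    (∀ x ∈ U, DifferentiableAt ℝ (fun y => ∑ c, ∑ d, a c d y * g c d y) x) ∧
      ∀ i, ∀ x ∈ U,
        lam i x = (1/2) * ∑ k, ginv g i k x * pd k (fun y => ∑ c, ∑ d, a c d y * g c d y) x := by
  have hgdiff : ∀ x ∈ U, ∀ i j, DifferentiableAt ℝ (g i j) x := fun x hx i j =>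
    ((hg.contDiff i j).contDiffAt (hU.mem_nhds hx)).differentiableAt one_ne_zero
  refine ⟨fun x hx => ?_, fun i x hx => ?_⟩
  · exact DifferentiableAt.fun_sum fun c _ => DifferentiableAt.fun_sum fun d _ =>
      (hadiff c d x hx).mul (hgdiff x hx c d)
  have htrace : ∀ k, pd k (fun y => ∑ c, ∑ d, a c d y * g c d y) x
      = 2 * (matAt g x).mulVec (fun c => lam c x) k := by
    intro k
    have hleft : ∑ c, ∑ d, a c d x * ∑ e, g d e x * Christoffel g e k c x =
        ∑ c, ∑ d, g c d x * ∑ e, Christoffel g c k e x * a e d x := by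
      simp only [Finset.mul_sum]
      rw [Finset.sum_congr rfl fun c _ => Finset.sum_comm, Finset.sum_comm]
      refine Finset.sum_congr rfl fun c _ => ?_
      rw [Finset.sum_comm]
      refine Finset.sum_congr rfl fun d _ => Finset.sum_congr rfl fun e _ => ?_
      rw [hg.symm d c x hx]
      ring
    have hright : ∑ c, ∑ d, a c d x * ∑ e, g c e x * Christoffel g e k d x =
        ∑ c, ∑ d, g c d x * ∑ e, Christoffel g d k e x * a c e x := by
      simp only [Finset.mul_sum]
      refine Finset.sum_congr rfl fun c _ => ?_
      rw [Finset.sum_comm]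
      refine Finset.sum_congr rfl fun d _ => Finset.sum_congr rfl fun e _ => ?_
      ring
    calc pd k (fun y => ∑ c, ∑ d, a c d y * g c d y) x
        = ∑ c, ∑ d, g c d x * (pd k (a c d) x + (∑ e, Christoffel g c k e x * a e d x)
            + ∑ e, Christoffel g d k e x * a c e x) := by
          rw [pd_sum_mul (fun c d => hadiff c d x hx) (hgdiff x hx)]
          simp only [hg.pd_eq_christoffel hU hx, mul_add, Finset.sum_add_distrib]
          rw [hleft, hright, add_assoc]
      _ = 2 * (matAt g x).mulVec (fun c => lam c x) k := by
          simp only [hsin _ _ _ x hx, mul_add, Finset.sum_add_distrib, mul_ite, mul_one, mul_zero,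
            Finset.sum_ite_eq', Finset.mem_univ, if_true]
          rw [Finset.sum_comm (f := fun c d => if c = k then g c d x * lam d x else 0)]
          simp only [Finset.sum_ite_eq', Finset.mem_univ, if_true, Matrix.mulVec, dotProduct,
            matAt, Matrix.of_apply, hg.symm _ k x hx]
          ring
  have hsolve := congrFun (congrArg (fun M => M.mulVec fun c => lam c x)
    (Matrix.nonsing_inv_mul _ (hg.inv x hx))) i
  simp only [← Matrix.mulVec_mulVec, Matrix.one_mulVec] at hsolve
  rw [← hsolve, Finset.mul_sum]
  change ∑ k, (matAt g x)⁻¹ i k * (matAt g x).mulVec (fun c => lam c x) k = _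
  refine Finset.sum_congr rfl fun k _ => ?_
  rw [htrace k, ginv]
  ring
end
end
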